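/- arXiv:1912.01746 — 6 statements merged into one kernel-verified Lean document; each statement's English description precedes it below -/
import Mathlib

section
/- Let P and L be real 3×3 skew-symmetric matrices. Then det(I − L·P) = (L₁₂·P₁₂ + L₁₃·P₁₃ + L₂₃·P₂₃ + 1)², where I is the 3×3 identity matrix and Aᵢⱼ denotes the (i,j) entry of A. -/
open Matrix

/-- A real skew-symmetric `3 × 3` matrix is determined by its entries above the diagonal. -/
theorem eq_of_transpose_eq_neg_three {A : Matrix (Fin 3) (Fin 3) ℝ} (hA : Aᵀ = -A) :
    A = !![0, A 0 1, A 0 2; -A 0 1, 0, A 1 2; -A 0 2, -A 1 2, 0] := by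
  have h (i j : Fin 3) : A j i = -A i j := congr_fun₂ hA i j
  have hdiag (i : Fin 3) : A i i = 0 := self_eq_neg.mp (h i i)
  ext i j
  fin_cases i <;> fin_cases j <;> simp [hdiag, h 0 1, h 0 2, h 1 2]

/-- Determinant computation for the gauge transformation on a 3-dimensional
manifold, at a point: `det(I − L·P) = (⟨λ,Π⟩ + 1)²`. -/
theorem gauge_det_three
    (P L : Matrix (Fin 3) (Fin 3) ℝ)
    (hP : Pᵀ = -P) (hL : Lᵀ = -L) :
    (1 - L * P).det =
      (L 0 1 * P 0 1 + L 0 2 * P 0 2 + L 1 2 * P 1 2 + 1) ^ 2 := by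
  rw [eq_of_transpose_eq_neg_three hP, eq_of_transpose_eq_neg_three hL]
  simp [det_fin_three]
  ring
end

section
/- Let P and L be real 3×3 skew-symmetric matrices, and set F := L₁₂·P₁₂ + L₁₃·P₁₃ + L₂₃·P₂₃ + 1. Then the matrix I − L·P is invertible if and only if F ≠ 0. -/
open Matrix

/-- For skew-symmetric `3 × 3` matrices, `det (1 - L * P)` is a perfect square. -/
theorem det_one_sub_mul_of_transpose_eq_neg {R : Type*} [CommRing R] [IsAddTorsionFree R]
    {P L : Matrix (Fin 3) (Fin 3) R} (hP : Pᵀ = -P) (hL : Lᵀ = -L) :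
    (1 - L * P).det = (L 0 1 * P 0 1 + L 0 2 * P 0 2 + L 1 2 * P 1 2 + 1) ^ 2 := by
  have skew {A : Matrix (Fin 3) (Fin 3) R} (hA : Aᵀ = -A) (i j) : A j i = -A i j :=
    congr_fun₂ hA i j
  have diag {A : Matrix (Fin 3) (Fin 3) R} (hA : Aᵀ = -A) (i) : A i i = 0 :=
    self_eq_neg.mp (skew hA i i)
  simp only [det_fin_three, Matrix.sub_apply, mul_apply, Fin.sum_univ_three, one_apply,
    diag hP, diag hL, skew hP 0 1, skew hP 0 2, skew hP 1 2, skew hL 0 1, skew hL 0 2,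
    skew hL 1 2, Fin.reduceEq, if_true, if_false]
  ring

/-- Pointwise invertibility condition for the gauge transformation on a
3-dimensional manifold: `I − L·P` is invertible iff `F ≠ 0`. -/
theorem gauge_invertible_iff_three
    (P L : Matrix (Fin 3) (Fin 3) ℝ)
    (hP : Pᵀ = -P) (hL : Lᵀ = -L)
    (F : ℝ) (hF : F = L 0 1 * P 0 1 + L 0 2 * P 0 2 + L 1 2 * P 1 2 + 1) :
    IsUnit (1 - L * P) ↔ F ≠ 0 := by
  rw [isUnit_iff_isUnit_det, det_one_sub_mul_of_transpose_eq_neg hP hL, ← hF,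
    isUnit_iff_ne_zero, pow_ne_zero_iff two_ne_zero]
end

section
/- Let U ⊆ ℝ³ be open, let Π : ℝ³ → Matrix (Fin 3) (Fin 3) ℝ be a bivector field on ℝ³ in coordinates that is differentiable on U, and let f : ℝ³ → ℝ be differentiable on U. Then the bivector field f·Π (with components (f·Π)ⁱʲ = f·Πⁱʲ) satisfies, at every point of U, J(f·Π)¹²³ = f² · J(Π)¹²³, where J denotes the Jacobiator. -/
open Matrix

open Finset

/-- The Jacobiator of a bivector field `Π` on `ℝᵐ` given in coordinates:
`J(Π)ⁱʲᵏ(x) = Σₛ (Πˢⁱ ∂ₛΠʲᵏ + Πˢʲ ∂ₛΠᵏⁱ + Πˢᵏ ∂ₛΠⁱʲ)(x)`. -/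
noncomputable def jacobiator {m : ℕ} (P : (Fin m → ℝ) → Matrix (Fin m) (Fin m) ℝ)
    (i j k : Fin m) (x : Fin m → ℝ) : ℝ :=
  ∑ s : Fin m,
    (P x s i * fderiv ℝ (fun y => P y j k) x (Pi.single s 1) +
     P x s j * fderiv ℝ (fun y => P y k i) x (Pi.single s 1) +
     P x s k * fderiv ℝ (fun y => P y i j) x (Pi.single s 1))

/-- On a 3-dimensional domain, rescaling a bivector field by a function
multiplies the (only) Jacobiator component by the square of the function:
`J(f·Π)¹²³ = f² · J(Π)¹²³` on `U`. -/
theorem jacobiator_smul_three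
    (U : Set (Fin 3 → ℝ)) (hU : IsOpen U)
    (P : (Fin 3 → ℝ) → Matrix (Fin 3) (Fin 3) ℝ)
    (hskew : ∀ x, (P x)ᵀ = -(P x))
    (hPdiff : ∀ i j : Fin 3, ∀ x ∈ U, DifferentiableAt ℝ (fun y => P y i j) x)
    (f : (Fin 3 → ℝ) → ℝ)
    (hfdiff : ∀ x ∈ U, DifferentiableAt ℝ f x) :
    ∀ x ∈ U,
      jacobiator (fun y => f y • P y) 0 1 2 x = (f x) ^ 2 * jacobiator P 0 1 2 x := by
  intro x hx
  have skew (i j : Fin 3) : P x j i = -P x i j := congrFun (congrFun (hskew x) i) j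
  have diag (i : Fin 3) : P x i i = 0 := by linarith [skew i i]
  have leibniz (i j : Fin 3) (v : Fin 3 → ℝ) :
      fderiv ℝ (fun y => f y * P y i j) x v =
        f x * fderiv ℝ (fun y => P y i j) x v + P x i j * fderiv ℝ f x v := by
    simp [fderiv_fun_mul (hfdiff x hx) (hPdiff i j x hx)]
  simp only [jacobiator, Matrix.smul_apply, smul_eq_mul, leibniz, Fin.sum_univ_three, diag,
    skew 0 1, skew 0 2, skew 1 2]
  ring
end

section
/- Let U ⊆ ℝ³ be open, let Π : ℝ³ → Matrix (Fin 3) (Fin 3) ℝ be a bivector field on ℝ³ in coordinates that is differentiable on U and is a Poisson bivector field on U, and let f : ℝ³ → ℝ be differentiable on U. Then f·Π (with components (f·Π)ⁱʲ = f·Πⁱʲ) is a Poisson bivector field on U. -/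
open Matrix

open Finset

/-- Leibniz rule for the Jacobiator of a rescaled bivector field. -/
theorem jacobiator_smul {m : ℕ} {P : (Fin m → ℝ) → Matrix (Fin m) (Fin m) ℝ}
    {f : (Fin m → ℝ) → ℝ} {x : Fin m → ℝ}
    (hP : ∀ i j : Fin m, DifferentiableAt ℝ (fun y => P y i j) x)
    (hf : DifferentiableAt ℝ f x) (i j k : Fin m) :
    jacobiator (fun y => f y • P y) i j k x =
      f x ^ 2 * jacobiator P i j k x +
        f x * ∑ s : Fin m, fderiv ℝ f x (Pi.single s 1) *
          (P x s i * P x j k + P x s j * P x k i + P x s k * P x i j) := by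
  have hderiv (a b : Fin m) (v : Fin m → ℝ) :
      fderiv ℝ (fun y => (f y • P y) a b) x v =
        f x * fderiv ℝ (fun y => P y a b) x v + P x a b * fderiv ℝ f x v := by
    simp only [Matrix.smul_apply, smul_eq_mul]
    rw [fderiv_fun_mul hf (hP a b)]
    simp
  simp only [jacobiator, hderiv, mul_sum, ← sum_add_distrib]
  refine sum_congr rfl fun s _ => ?_
  simp only [Matrix.smul_apply, smul_eq_mul]
  ring

/-- The Plücker relation: a skew-symmetric `3 × 3` matrix has decomposable bivector. -/
theorem pluecker_of_skew_three {A : Matrix (Fin 3) (Fin 3) ℝ} (hA : Aᵀ = -A) (s i j k : Fin 3) :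
    A s i * A j k + A s j * A k i + A s k * A i j = 0 := by
  have hskew (a b : Fin 3) : A b a = -A a b := by
    simpa using congrFun (congrFun hA a) b
  have hdiag (a : Fin 3) : A a a = 0 := self_eq_neg.mp (hskew a a)
  have h10 := hskew 0 1
  have h20 := hskew 0 2
  have h21 := hskew 1 2
  fin_cases s <;> fin_cases i <;> fin_cases j <;> fin_cases k <;>
    simp [hdiag, h10, h20, h21] <;> ring

/-- On a 3-dimensional domain, rescaling a Poisson bivector field by a
differentiable function again yields a Poisson bivector field. -/
theorem smul_poisson_three
    (U : Set (Fin 3 → ℝ)) (hU : IsOpen U)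
    (P : (Fin 3 → ℝ) → Matrix (Fin 3) (Fin 3) ℝ)
    (hskew : ∀ x, (P x)ᵀ = -(P x))
    (hPdiff : ∀ i j : Fin 3, ∀ x ∈ U, DifferentiableAt ℝ (fun y => P y i j) x)
    (hPoisson : ∀ x ∈ U, ∀ i j k : Fin 3, i < j → j < k → jacobiator P i j k x = 0)
    (f : (Fin 3 → ℝ) → ℝ)
    (hfdiff : ∀ x ∈ U, DifferentiableAt ℝ f x) :
    ∀ x ∈ U, ∀ i j k : Fin 3, i < j → j < k →
      jacobiator (fun y => f y • P y) i j k x = 0 := by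
  intro x hx i j k hij hjk
  rw [jacobiator_smul (fun a b => hPdiff a b x hx) (hfdiff x hx), hPoisson x hx i j k hij hjk]
  simp [pluecker_of_skew_three (hskew x)]
end

section
/- (Lemma 3.2, first case.) Let a₁, a₂, a₃ ∈ ℝ and let Π be the bivector field on ℝ⁴ in coordinates with components Π¹²(x) = a₁x₂, Π¹³(x) = a₂x₃, Π¹⁴(x) = a₃x₄, and Π²³(x) = Π²⁴(x) = Π³⁴(x) = 0 (and skew-symmetry). Then Π is a Poisson bivector field on ℝ⁴, i.e. J(Π)ⁱʲᵏ(x) = 0 for all x ∈ ℝ⁴ and all 1 ≤ i < j < k ≤ 4. -/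
open Matrix

open Finset

theorem fderiv_const_mul_apply_single {m : ℕ} (c : ℝ) (l s : Fin m) (x : Fin m → ℝ) :
    fderiv ℝ (fun y : Fin m → ℝ => c * y l) x (Pi.single s 1) =
      c * (Pi.single s 1 : Fin m → ℝ) l := by
  have h : HasFDerivAt (fun y : Fin m → ℝ => c * y l)
      (c • ContinuousLinearMap.proj (R := ℝ) (φ := fun _ : Fin m => ℝ) l) x :=
    (hasFDerivAt_apply l x).const_mul c
  simp [h.fderiv]

/-- Lemma 3.2, first case: for `a₄ = 0`, the 3-parametric family
`Π = a₁x₂ ∂₁∧∂₂ + a₂x₃ ∂₁∧∂₃ + a₃x₄ ∂₁∧∂₄` is Poisson on ℝ⁴. -/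
theorem three_parametric_poisson
    (a₁ a₂ a₃ : ℝ)
    (P : (Fin 4 → ℝ) → Matrix (Fin 4) (Fin 4) ℝ)
    (hskew : ∀ x, (P x)ᵀ = -(P x))
    (h12 : ∀ x, P x 0 1 = a₁ * x 1)
    (h13 : ∀ x, P x 0 2 = a₂ * x 2)
    (h14 : ∀ x, P x 0 3 = a₃ * x 3)
    (h23 : ∀ x, P x 1 2 = 0)
    (h24 : ∀ x, P x 1 3 = 0)
    (h34 : ∀ x, P x 2 3 = 0) :
    ∀ x : Fin 4 → ℝ, ∀ i j k : Fin 4, i < j → j < k →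
      jacobiator P i j k x = 0 := by
  have skew (x) (i j : Fin 4) : P x j i = -P x i j := congrFun (congrFun (hskew x) i) j
  have diag (x) (i : Fin 4) : P x i i = 0 := by linarith [skew x i i]
  have h21 (x) : P x 1 0 = -a₁ * x 1 := by rw [skew x 0 1, h12, neg_mul]
  have h31 (x) : P x 2 0 = -a₂ * x 2 := by rw [skew x 0 2, h13, neg_mul]
  have h41 (x) : P x 3 0 = -a₃ * x 3 := by rw [skew x 0 3, h14, neg_mul]
  have h32 (x) : P x 2 1 = 0 := by rw [skew x 1 2, h23, neg_zero]
  have h42 (x) : P x 3 1 = 0 := by rw [skew x 1 3, h24, neg_zero]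
  have h43 (x) : P x 3 2 = 0 := by rw [skew x 2 3, h34, neg_zero]
  intro x i j k hij hjk
  fin_cases i <;> fin_cases j <;> first | exact absurd hij (by decide) | skip
  all_goals fin_cases k <;> first | exact absurd hjk (by decide) | skip
  all_goals
    simp only [jacobiator, Fin.sum_univ_four, Fin.zero_eta, Fin.mk_one, Fin.reduceFinMk,
      diag, h12, h13, h14, h23, h24, h34, h21, h31, h41, h32, h42, h43,
      fderiv_const_mul_apply_single]
    simp
end

section
/- Let a₁, a₂, a₃, a₄ ∈ ℝ and let Π be the bivector field on ℝ⁴ in coordinates with components Π¹²(x) = a₁x₂, Π¹³(x) = a₂x₃, Π¹⁴(x) = a₃x₄, Π²³(x) = a₄x₁, Π²⁴(x) = 0, Π³⁴(x) = 0 (and skew-symmetry). Then Π is a Poisson bivector field on ℝ⁴ if and only if a₄ = 0, or (a₂ = −a₁ and a₃ = 0). -/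
open Matrix

open Finset

/-- The derivative of a scalar multiple of a coordinate function in a coordinate direction. -/
lemma fderiv_const_mul_coord_single {ι : Type*} [Fintype ι] [DecidableEq ι] (c : ℝ) (i s : ι)
    (x : ι → ℝ) :
    fderiv ℝ (fun y : ι → ℝ => c * y i) x (Pi.single s 1) = if i = s then c else 0 := by
  have h : HasFDerivAt (fun y : ι → ℝ => c * y i)
      (c • ContinuousLinearMap.proj (R := ℝ) (φ := fun _ : ι => ℝ) i) x :=
    (hasFDerivAt_apply (𝕜 := ℝ) i x).const_mul c
  rw [h.fderiv]
  simp [Pi.single_apply]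

/-- The 4-parametric bivector field
`Π = a₁x₂ ∂₁∧∂₂ + a₂x₃ ∂₁∧∂₃ + a₃x₄ ∂₁∧∂₄ + a₄x₁ ∂₂∧∂₃` on ℝ⁴ is Poisson
iff `a₄ = 0`, or `a₂ = −a₁` and `a₃ = 0`. -/
theorem four_parametric_poisson_iff
    (a₁ a₂ a₃ a₄ : ℝ)
    (P : (Fin 4 → ℝ) → Matrix (Fin 4) (Fin 4) ℝ)
    (hskew : ∀ x, (P x)ᵀ = -(P x))
    (h12 : ∀ x, P x 0 1 = a₁ * x 1)
    (h13 : ∀ x, P x 0 2 = a₂ * x 2)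
    (h14 : ∀ x, P x 0 3 = a₃ * x 3)
    (h23 : ∀ x, P x 1 2 = a₄ * x 0)
    (h24 : ∀ x, P x 1 3 = 0)
    (h34 : ∀ x, P x 2 3 = 0) :
    (∀ x : Fin 4 → ℝ, ∀ i j k : Fin 4, i < j → j < k →
      jacobiator P i j k x = 0) ↔ (a₄ = 0 ∨ (a₂ = -a₁ ∧ a₃ = 0)) := by
  have skew : ∀ i j x, P x j i = -P x i j := fun i j x => congrFun₂ (hskew x) i j
  have diag : ∀ i x, P x i i = 0 := fun i x => by linarith [skew i i x]
  have h21 : ∀ x, P x 1 0 = -a₁ * x 1 := fun x => by rw [skew 0 1, h12, neg_mul]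
  have h31 : ∀ x, P x 2 0 = -a₂ * x 2 := fun x => by rw [skew 0 2, h13, neg_mul]
  have h41 : ∀ x, P x 3 0 = -a₃ * x 3 := fun x => by rw [skew 0 3, h14, neg_mul]
  have h32 : ∀ x, P x 2 1 = -a₄ * x 0 := fun x => by rw [skew 1 2, h23, neg_mul]
  have h42 : ∀ x, P x 3 1 = 0 := fun x => by rw [skew 1 3, h24, neg_zero]
  have h43 : ∀ x, P x 3 2 = 0 := fun x => by rw [skew 2 3, h34, neg_zero]
  have j123 : ∀ x, jacobiator P 0 1 2 x = a₄ * (a₁ + a₂) * x 0 := fun x => by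
    simp only [jacobiator, Fin.sum_univ_four, diag, h12, h13, h23, h21, h31, h41, h32, h42, h43,
      fderiv_const_mul_coord_single]
    simp
    ring
  have j124 : ∀ x, jacobiator P 0 1 3 x = 0 := fun x => by
    simp only [jacobiator, Fin.sum_univ_four, diag, h12, h14, h24, h34, h21, h31, h41, h32, h42,
      fderiv_const_mul_coord_single]
    simp
  have j134 : ∀ x, jacobiator P 0 2 3 x = 0 := fun x => by
    simp only [jacobiator, Fin.sum_univ_four, diag, h13, h14, h23, h24, h34, h21, h31, h41, h43,
      fderiv_const_mul_coord_single]
    simp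
  have j234 : ∀ x, jacobiator P 1 2 3 x = a₃ * a₄ * x 3 := fun x => by
    simp only [jacobiator, Fin.sum_univ_four, diag, h12, h13, h14, h23, h24, h34, h32, h42, h43,
      fderiv_const_mul_coord_single]
    simp
    ring
  constructor
  · intro h
    have e₁ := h 1 0 1 2 (by decide) (by decide)
    have e₂ := h 1 1 2 3 (by decide) (by decide)
    rw [j123, Pi.one_apply, mul_one] at e₁
    rw [j234, Pi.one_apply, mul_one] at e₂
    refine or_iff_not_imp_left.2 fun ha => ⟨?_, (mul_eq_zero.1 e₂).resolve_right ha⟩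
    linarith [(mul_eq_zero.1 e₁).resolve_left ha]
  · intro h x i j k hij hjk
    have h₁ : a₄ * (a₁ + a₂) = 0 := by rcases h with h | ⟨h, -⟩ <;> simp [h]
    have h₂ : a₃ * a₄ = 0 := by rcases h with h | ⟨-, h⟩ <;> simp [h]
    have cases : (i = 0 ∧ j = 1 ∧ k = 2) ∨ (i = 0 ∧ j = 1 ∧ k = 3) ∨
        (i = 0 ∧ j = 2 ∧ k = 3) ∨ (i = 1 ∧ j = 2 ∧ k = 3) := by omega
    rcases cases with ⟨rfl, rfl, rfl⟩ | ⟨rfl, rfl, rfl⟩ | ⟨rfl, rfl, rfl⟩ | ⟨rfl, rfl, rfl⟩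
    · rw [j123, h₁, zero_mul]
    · exact j124 x
    · exact j134 x
    · rw [j234, h₂, zero_mul]
end
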